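/- Let q be an odd prime power and a ∈ F_q, a ≠ 0. Let G_q(a) be the graph with vertex set F_q² in which distinct vertices x, y are adjacent iff ‖x−y‖ = a. Then G_q(a) is regular of valency d for some d ∈ {q−1, q+1}, and every eigenvalue μ of the real adjacency matrix of G_q(a) with μ ≠ d satisfies |μ| ≤ 2√q. -/

import Mathlib

open Matrix

/-- The norm `‖x‖ = x₁² + x₂²` on `F_q²`. -/
def fnorm {F : Type*} [Field F] (x : Fin 2 → F) : F := x 0 ^ 2 + x 1 ^ 2

/-- The Kloosterman sum attached to an additive character. -/
noncomputable def kl {K : Type} [Field K] [Fintype K] (ψ : AddChar K ℂ) (u v : K) : ℂ :=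
  open Classical in ∑ x : K, if x = 0 then 0 else ψ (u * x + v * x⁻¹)

theorem two_ne_zero_of_odd {K : Type} [Field K] [Fintype K] (hq : Odd (Fintype.card K)) :
    (2 : K) ≠ 0 := by
  intro h
  have h1 : ringChar K ≠ 2 := by
    intro h2
    have := FiniteField.even_card_iff_char_two.mp h2
    rw [Nat.odd_iff] at hq
    omega
  exact Ring.two_ne_zero h1 h

theorem ringChar_ne_of_odd {K : Type} [Field K] [Fintype K] (hq : Odd (Fintype.card K)) :
    ringChar K ≠ 2 := by
  intro h2
  have := FiniteField.even_card_iff_char_two.mp h2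
  rw [Nat.odd_iff] at hq
  omega

theorem sum_sq_eq {K : Type} [Field K] [Fintype K] [DecidableEq K] (hq : Odd (Fintype.card K))
    (g : K → ℂ) :
    ∑ w : K, g (w ^ 2) = ∑ k : K, ((quadraticChar K k : ℂ) + 1) * g k := by
  have := Finset.sum_fiberwise (s := (Finset.univ : Finset K)) (g := fun w : K => w ^ 2)
    (f := fun w => g (w ^ 2))
  rw [← this]
  refine Finset.sum_congr rfl fun k _ => ?_
  have h := quadraticChar_card_sqrts (ringChar_ne_of_odd hq) k
  have h2 : ((quadraticChar K k : ℂ) + 1)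
      = ((Finset.univ.filter fun w : K => w ^ 2 = k).card : ℂ) := by
    have h3 : {x : K | x ^ 2 = k}.toFinset = Finset.univ.filter fun w : K => w ^ 2 = k := by
      ext; simp
    rw [h3] at h
    have := congrArg (Int.cast : ℤ → ℂ) h
    push_cast at this
    rw [this]
  rw [h2, Finset.sum_congr rfl (g := fun _ => g k)]
  · simp
  · intro x hx
    rw [(Finset.mem_filter.mp hx).2]

theorem sum_sq_add {K : Type} [Field K] [Fintype K] (hq : Odd (Fintype.card K))
    (c : K) (hc : ¬ IsSquare c) (g : K → ℂ) :
    ∑ w : K, g (w ^ 2) + ∑ w : K, g (c * w ^ 2) = 2 * ∑ k : K, g k := by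
  classical
  have hc0 : c ≠ 0 := by rintro rfl; exact hc (IsSquare.zero)
  rw [sum_sq_eq hq g, sum_sq_eq hq (fun k => g (c * k))]
  have h : ∑ k : K, ((quadraticChar K k : ℂ) + 1) * g k
      = ∑ k : K, ((quadraticChar K (c * k) : ℂ) + 1) * g (c * k) :=
    (Fintype.sum_equiv (Equiv.mulLeft₀ c hc0) _ _ (fun k => rfl)).symm
  have h' : ∑ k : K, g k = ∑ k : K, g (c * k) :=
    (Fintype.sum_equiv (Equiv.mulLeft₀ c hc0) _ _ (fun k => rfl)).symm
  rw [h, h', ← Finset.sum_add_distrib, Finset.mul_sum]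
  refine Finset.sum_congr rfl fun k _ => ?_
  rw [map_mul, quadraticChar_neg_one_iff_not_isSquare.mpr hc]
  push_cast
  ring

theorem kl_quad {K L : Type} [Field K] [Fintype K] [Field L] [Fintype L]
    (hq : Odd (Fintype.card K)) (ψ : AddChar K ℂ) (hψ : ψ.IsPrimitive)
    (Ψ : AddChar L ℂ) (c : K) (hc : ¬ IsSquare c) (e : L ≃ K × K)
    (u v : K) (hu : u ≠ 0) (hv : v ≠ 0) (u' v' : L)
    (he0 : ∀ x, x = 0 ↔ (e x).1 ^ 2 - c * (e x).2 ^ 2 = 0)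
    (he : ∀ x, x ≠ 0 → Ψ (u' * x + v' * x⁻¹) =
      ψ ((e x).1 * (2 * (u + v * ((e x).1 ^ 2 - c * (e x).2 ^ 2)⁻¹)))) :
    kl Ψ u' v' = 2 * Fintype.card K - (kl ψ u v) ^ 2 := by
  classical
  have h2 := two_ne_zero_of_odd hq
  set g : K → K → ℂ := fun s k =>
    if s ^ 2 - k = 0 then 0 else ψ (s * (2 * (u + v * (s ^ 2 - k)⁻¹))) with hg
  have h1 : kl Ψ u' v' = ∑ s : K, ∑ w : K, g s (c * w ^ 2) := by
    rw [← Fintype.sum_prod_type', kl]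
    refine Fintype.sum_equiv e _ _ fun x => ?_
    simp only [hg]
    by_cases hx : x = 0
    · rw [if_pos hx, if_pos ((he0 x).mp hx)]
    · rw [if_neg hx, if_neg (fun h => hx ((he0 x).mpr h)), he x hx]
  let e2 : K × K ≃ K × K :=
    { toFun := fun p => (p.1 + p.2, p.1 - p.2)
      invFun := fun p => ((p.1 + p.2) / 2, (p.1 - p.2) / 2)
      left_inv := by
        rintro ⟨a, b⟩
        ext
        · show (a + b + (a - b)) / 2 = a
          field_simp; ring
        · show (a + b - (a - b)) / 2 = b
          field_simp; ring
      right_inv := by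
        rintro ⟨a, b⟩
        ext
        · show (a + b) / 2 + (a - b) / 2 = a
          field_simp; ring
        · show (a + b) / 2 - (a - b) / 2 = b
          field_simp; ring }
  have h3 : (kl ψ u v) ^ 2 = ∑ s : K, ∑ w : K, g s (w ^ 2) := by
    rw [← Fintype.sum_prod_type', kl, sq, Finset.sum_mul_sum, ← Fintype.sum_prod_type']
    symm
    refine Fintype.sum_equiv e2 _ _ ?_
    rintro ⟨s, w⟩
    show g s (w ^ 2) = (if s + w = 0 then 0 else ψ (u * (s + w) + v * (s + w)⁻¹)) *
      (if s - w = 0 then 0 else ψ (u * (s - w) + v * (s - w)⁻¹))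
    have hf : s ^ 2 - w ^ 2 = (s + w) * (s - w) := by ring
    simp only [hg, hf]
    by_cases ha : s + w = 0
    · simp [ha]
    by_cases hb : s - w = 0
    · simp [hb]
    rw [if_neg (mul_ne_zero ha hb), if_neg ha, if_neg hb, ← AddChar.map_add_eq_mul]
    congr 1
    field_simp
    ring
  have h4 : (kl ψ u v) ^ 2 + kl Ψ u' v' = 2 * Fintype.card K := by
    rw [h3, h1, ← Finset.sum_add_distrib]
    simp_rw [sum_sq_add hq c hc]
    rw [← Finset.mul_sum]
    congr 1
    have h5 : ∀ s : K, ∑ k : K, g s k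
        = ∑ n : K, if n = 0 then 0 else ψ (s * (2 * (u + v * n⁻¹))) := by
      intro s
      refine Fintype.sum_equiv (Equiv.subLeft (s ^ 2)) _ _ fun k => ?_
      simp [hg]
    simp_rw [h5]
    rw [Finset.sum_comm]
    have h6 : ∀ n : K, (∑ s : K, if n = 0 then 0 else ψ (s * (2 * (u + v * n⁻¹))))
        = if n = - v / u then (Fintype.card K : ℂ) else 0 := by
      intro n
      by_cases hn : n = 0
      · have : ¬ (0 : K) = - v / u := by
          intro h
          have := div_ne_zero (neg_ne_zero.mpr hv) hu
          exact this h.symm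
        simp [hn, this]
      · simp only [hn, if_false]
        rw [AddChar.sum_mulShift _ hψ]
        have : (2 * (u + v * n⁻¹) = 0) ↔ n = - v / u := by
          constructor
          · intro h
            have h := (mul_eq_zero.mp h).resolve_left h2
            field_simp at h ⊢
            linear_combination h
          · intro h
            have : u * n + v = 0 := by
              rw [h]; field_simp; ring
            have h7 : u + v * n⁻¹ = (u * n + v) * n⁻¹ := by field_simp
            rw [h7, this]; ring
        simp only [this]
        split_ifs <;> simp
    simp_rw [h6]
    simp
  rw [← h4]; ring

theorem inj_aux {S q c b a c' b' a' : ℕ} (hc : c < S) (hc' : c' < S) (hb : b < q) (hb' : b' < q)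
    (h : c + S * (b + q * a) = c' + S * (b' + q * a')) : c = c' ∧ b = b' ∧ a = a' := by
  have h1 : c = c' := by
    have := congrArg (· % S) h
    simpa [Nat.add_mul_mod_self_left, Nat.mod_eq_of_lt hc, Nat.mod_eq_of_lt hc'] using this
  have h2 : b + q * a = b' + q * a' := by
    subst h1
    exact Nat.eq_of_mul_eq_mul_left (by omega : 0 < S) (by omega)
  have h3 : b = b' := by
    have := congrArg (· % q) h2
    simpa [Nat.add_mul_mod_self_left, Nat.mod_eq_of_lt hb, Nat.mod_eq_of_lt hb'] using this
  refine ⟨h1, h3, ?_⟩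
  subst h3
  exact Nat.eq_of_mul_eq_mul_left (by omega : 0 < q) (by omega)

open Polynomial in
/-- Linear algebra part of the Stepanov argument. -/
theorem stepanov_aux {F : Type} [Field F] (S k : ℕ) (hS : 1 ≤ S) (hk : 1 ≤ k)
    (B D : F[X]) (hB : B.natDegree ≤ 2 * S) (hD : D.natDegree = 2 * S) :
    ∃ h : Fin S × Fin (k + 1) × Fin (S + 2) → F,
      (∑ i, C (h i) * (X ^ (S * (k + 1) * i.1.val + i.2.2.val + S * (k - i.2.1.val))
        * B ^ i.2.1.val) = 0) ∧
      (∑ i, C (h i) * (X ^ (i.1.val + S * (k + 1) * i.2.2.val + S * (k - i.2.1.val))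
        * D ^ i.2.1.val) ≠ 0) ∧
      (∑ i, C (h i) * (X ^ (i.1.val + S * (k + 1) * i.2.2.val + S * (k - i.2.1.val))
        * D ^ i.2.1.val)).natDegree ≤ S * (S * (k + 1)) + 3 * (S * (k + 1)) := by
  classical
  have hD0 : D ≠ 0 := by rintro rfl; simp at hD; omega
  set P : Fin S × Fin (k + 1) × Fin (S + 2) → F[X] := fun i =>
    X ^ (S * (k + 1) * i.1.val + i.2.2.val + S * (k - i.2.1.val)) * B ^ i.2.1.val with hP
  set T : Fin S × Fin (k + 1) × Fin (S + 2) → F[X] := fun i =>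
    X ^ (i.1.val + S * (k + 1) * i.2.2.val + S * (k - i.2.1.val)) * D ^ i.2.1.val with hT
  set M := S * (S * (k + 1)) + S * (k + 1) + 1 with hM
  have hPd : ∀ i, (P i).natDegree < M := by
    rintro ⟨⟨c, hc⟩, ⟨b, hb⟩, ⟨a, ha⟩⟩
    have h1 : (P ⟨⟨c, hc⟩, ⟨b, hb⟩, ⟨a, ha⟩⟩).natDegree ≤
        (S * (k + 1) * c + a + S * (k - b)) + b * (2 * S) := by
      simp only [hP]
      refine natDegree_mul_le.trans (add_le_add (natDegree_X_pow_le _) ?_)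
      exact natDegree_pow_le.trans (Nat.mul_le_mul_left _ hB)
    obtain ⟨b', rfl⟩ : ∃ b', k = b + b' := ⟨k - b, by omega⟩
    obtain ⟨c', rfl⟩ : ∃ c', S = c + c' + 1 := ⟨S - c - 1, by omega⟩
    rw [Nat.add_sub_cancel_left] at h1
    refine h1.trans_lt ?_
    rw [hM]
    have : a ≤ c + c' + 2 := by omega
    nlinarith [Nat.zero_le (c * b), Nat.zero_le (c * b'), Nat.zero_le (c' * b), Nat.zero_le (c' * b'), Nat.zero_le (c' * c'), Nat.zero_le (c*c'), mul_nonneg (Nat.zero_le b) (Nat.zero_le (c'*c)), Nat.zero_le (c' * (c + c' + 1) * (b + b' + 1))]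
  have hTd : ∀ i, T i ≠ 0 ∧ (T i).natDegree = (i.1.val + S * (i.2.1.val + (k + 1) * i.2.2.val)) + S * k := by
    rintro ⟨⟨c, hc⟩, ⟨b, hb⟩, ⟨a, ha⟩⟩
    refine ⟨mul_ne_zero (pow_ne_zero _ X_ne_zero) (pow_ne_zero _ hD0), ?_⟩
    simp only [hT]
    rw [natDegree_mul (pow_ne_zero _ X_ne_zero) (pow_ne_zero _ hD0), natDegree_pow, natDegree_pow,
      natDegree_X, hD]
    obtain ⟨b', rfl⟩ : ∃ b', k = b + b' := ⟨k - b, by omega⟩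
    rw [Nat.add_sub_cancel_left]
    ring
  let Lm : (Fin S × Fin (k + 1) × Fin (S + 2) → F) →ₗ[F] (Fin M → F) :=
    { toFun := fun h j => (∑ i, C (h i) * P i).coeff j
      map_add' := by
        intro h h'
        ext j
        simp [coeff_C_mul, add_mul, Finset.sum_add_distrib]
      map_smul' := by
        intro r h
        ext j
        simp [coeff_C_mul, mul_assoc, Finset.mul_sum] }
  have hker : LinearMap.ker Lm ≠ ⊥ := by
    apply LinearMap.ker_ne_bot_of_finrank_lt
    simp only [Module.finrank_fintype_fun_eq_card, Fintype.card_fin, Fintype.card_prod]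
    rw [hM]
    have : 1 ≤ S * k := Nat.one_le_iff_ne_zero.mpr (by positivity)
    nlinarith
  obtain ⟨h, hh, hne⟩ := (Submodule.ne_bot_iff _).mp hker
  refine ⟨h, ?_, ?_, ?_⟩
  · show ∑ i, C (h i) * P i = 0
    ext j
    by_cases hj : j < M
    · have := congrFun (LinearMap.mem_ker.mp hh) ⟨j, hj⟩
      rw [coeff_zero]
      exact this
    · rw [coeff_zero]
      apply coeff_eq_zero_of_natDegree_lt
      refine lt_of_lt_of_le ?_ (not_lt.mp hj)
      have : (∑ i, C (h i) * P i).natDegree ≤ M - 1 := by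
        apply natDegree_sum_le_of_forall_le
        intro i _
        have h1 := natDegree_C_mul_le (h i) (P i)
        have h2 := hPd i
        omega
      omega
  · show ∑ i, C (h i) * T i ≠ 0
    have hdeg := degree_sum_eq_of_disjoint (fun i => C (h i) * T i) Finset.univ (by
      intro i hi j hj hij heq
      have hi0 : h i ≠ 0 := by
        rintro h0
        exact hi.2 (by simp [h0])
      have hj0 : h j ≠ 0 := by
        rintro h0
        exact hj.2 (by simp [h0])
      have h1 : (T i).natDegree = (T j).natDegree := by
        have h2 : (C (h i) * T i).degree = (C (h j) * T j).degree := heq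
        rw [degree_C_mul hi0, degree_C_mul hj0] at h2
        exact natDegree_eq_of_degree_eq h2
      rw [(hTd i).2, (hTd j).2] at h1
      have h3 := inj_aux i.1.isLt j.1.isLt i.2.1.isLt j.2.1.isLt (Nat.add_right_cancel h1)
      apply hij
      ext
      · exact h3.1
      · exact h3.2.1
      · exact h3.2.2)
    obtain ⟨i, hi⟩ := Function.ne_iff.mp hne
    intro h0
    rw [h0, degree_zero] at hdeg
    have := Finset.le_sup (f := fun i => (C (h i) * T i).degree) (Finset.mem_univ i)
    rw [← hdeg] at this
    have h3 := degree_eq_bot.mp (le_bot_iff.mp this)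
    exact (mul_ne_zero (C_ne_zero.mpr hi) (hTd i).1) h3
  · show (∑ i, C (h i) * T i).natDegree ≤ _
    apply natDegree_sum_le_of_forall_le
    intro i _
    refine (natDegree_C_mul_le (h i) (T i)).trans ?_
    rw [(hTd i).2]
    obtain ⟨⟨c, hc⟩, ⟨b, hb⟩, ⟨a, ha⟩⟩ := i
    simp only
    have hb2 : b ≤ k := by omega
    have ha2 : a ≤ S + 1 := by omega
    have e1 : S * ((k + 1) * a) ≤ S * ((k + 1) * (S + 1)) := by gcongr
    have e2 : S * b ≤ S * k := by gcongr
    nlinarith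

theorem stepanov {F K : Type} [Field F] [Fintype F] [Field K] [Fintype K] [Algebra F K]
    (m : ℕ) (hK : Fintype.card K = (Fintype.card F ^ (m + 1)) ^ 2)
    (u v : F) (hu : u ≠ 0) (e : F) (s : Finset K)
    (hs : ∀ x ∈ s, x ≠ 0 ∧
      Algebra.trace F K (algebraMap F K u * x + algebraMap F K v * x⁻¹) = e) :
    s.card ≤ Fintype.card F ^ m * Fintype.card F ^ (m + 1) + 3 * Fintype.card F ^ (m + 1) := by
  classical
  obtain ⟨k, hk⟩ : ∃ k, Fintype.card F = k + 1 := ⟨Fintype.card F - 1, by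
    have := Fintype.card_pos (α := F); omega⟩
  have hk1 : 1 ≤ k := by
    have := Fintype.one_lt_card (α := F); omega
  set q := Fintype.card F with hq
  set S := q ^ m with hSdef
  have hR : q ^ (m + 1) = S * (k + 1) := by rw [pow_succ, ← hk]
  have hS : 1 ≤ S := Nat.one_le_pow _ _ (by omega)
  set A : K → K := fun x => ∑ i ∈ Finset.range (m + 1),
    (algebraMap F K u * x + algebraMap F K v * x⁻¹) ^ (q ^ i) with hA
  set B : Polynomial F := ∑ i ∈ Finset.range (m + 1),
    (Polynomial.C u * Polynomial.X ^ (S + q ^ i) + Polynomial.C v * Polynomial.X ^ (S - q ^ i))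
    with hBdef
  have hle : ∀ i ∈ Finset.range (m + 1), q ^ i ≤ S := fun i hi =>
    Nat.pow_le_pow_right (by omega) (by have := Finset.mem_range.mp hi; omega)
  have hB : B.natDegree ≤ 2 * S := by
    apply Polynomial.natDegree_sum_le_of_forall_le
    intro i hi
    have := hle i hi
    refine (Polynomial.natDegree_add_le _ _).trans (max_le ?_ ?_)
    · exact (Polynomial.natDegree_C_mul_X_pow_le _ _).trans (by omega)
    · exact (Polynomial.natDegree_C_mul_X_pow_le _ _).trans (by omega)
  have hBc : B.coeff (2 * S) = u := by
    rw [hBdef, Polynomial.finsetSum_coeff, Finset.sum_eq_single m]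
    · simp only [Polynomial.coeff_add, Polynomial.coeff_C_mul_X_pow]
      rw [if_pos (by rw [hSdef]; omega), if_neg (by have : 0 < q ^ m := hS; omega), add_zero]
    · intro i hi him
      have hlt : q ^ i < S := Nat.pow_lt_pow_right (by omega)
        (by have := Finset.mem_range.mp hi; omega)
      simp only [Polynomial.coeff_add, Polynomial.coeff_C_mul_X_pow]
      rw [if_neg (by omega), if_neg (by omega), add_zero]
    · simp
  set D : Polynomial F := Polynomial.C e * Polynomial.X ^ S - B with hDdef
  have hD : D.natDegree = 2 * S := by
    apply le_antisymm
    · refine (Polynomial.natDegree_sub_le _ _).trans (max_le ?_ hB)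
      exact (Polynomial.natDegree_C_mul_X_pow_le _ _).trans (by omega)
    · apply Polynomial.le_natDegree_of_ne_zero
      rw [hDdef, Polynomial.coeff_sub, hBc, Polynomial.coeff_C_mul_X_pow, if_neg (by omega)]
      simpa using hu
  obtain ⟨h, h1, h2, h3⟩ := stepanov_aux S k hS hk1 B D hB hD
  set Φ := ∑ i, Polynomial.C (h i) * (Polynomial.X ^ (i.1.val + S * (k + 1) * i.2.2.val
    + S * (k - i.2.1.val)) * D ^ i.2.1.val) with hΦ
  -- Frobenius
  let σ : K →ₐ[F] K := (FiniteField.frobeniusAlgHom F K) ^ (m + 1)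
  have hσ : ∀ x, σ x = x ^ (S * (k + 1)) := by
    intro x
    rw [← hR]
    show ((FiniteField.frobeniusAlgHom F K) ^ (m + 1)) x = _
    rw [AlgHom.coe_pow, FiniteField.coe_frobeniusAlgHom, pow_iterate]
  have hσσ : ∀ x, σ (σ x) = x := by
    intro x
    rw [hσ, hσ, ← pow_mul, ← hR, ← sq, ← hK, FiniteField.pow_card]
  have hfin : Module.finrank F K = (m + 1) + (m + 1) := by
    have := Module.card_eq_pow_finrank (K := F) (V := K)
    rw [hK, ← pow_mul] at this
    have := Nat.pow_right_injective (by omega : 2 ≤ q) this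
    omega
  have hBev : ∀ x : K, x ≠ 0 → Polynomial.aeval x B = x ^ S * A x := by
    intro x hx
    rw [hBdef, hA, map_sum, Finset.mul_sum]
    refine Finset.sum_congr rfl fun i hi => ?_
    have hf : (algebraMap F K u * x + algebraMap F K v * x⁻¹) ^ (q ^ i)
        = algebraMap F K u * x ^ (q ^ i) + algebraMap F K v * (x ^ (q ^ i))⁻¹ := by
      have hτ : ∀ y : K, y ^ (q ^ i) = ((FiniteField.frobeniusAlgHom F K) ^ i) y := by
        intro y
        rw [AlgHom.coe_pow, FiniteField.coe_frobeniusAlgHom, pow_iterate]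
      rw [hτ, map_add, map_mul, map_mul, AlgHom.commutes, AlgHom.commutes, ← hτ, map_inv₀, ← hτ]
    rw [hf]
    simp only [map_add, map_mul, Polynomial.aeval_C, map_pow, Polynomial.aeval_X]
    rw [pow_add, pow_sub₀ x hx (hle i hi)]
    ring
  have key : ∀ x ∈ s, Polynomial.aeval x Φ = 0 := by
    intro x hx
    obtain ⟨hx0, htr⟩ := hs x hx
    have hy0 : σ x ≠ 0 := by
      rw [hσ]; exact pow_ne_zero _ hx0
    have hAA : algebraMap F K e - A (σ x) = A x := by
      have ht := FiniteField.algebraMap_trace_eq_sum_pow F K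
        (algebraMap F K u * x + algebraMap F K v * x⁻¹)
      rw [htr, hfin, Finset.sum_range_add, Nat.card_eq_fintype_card, ← hq] at ht
      rw [ht, sub_eq_iff_eq_add]
      have : ∀ i ∈ Finset.range (m + 1),
          (algebraMap F K u * x + algebraMap F K v * x⁻¹) ^ (q ^ (m + 1 + i))
          = (algebraMap F K u * σ x + algebraMap F K v * (σ x)⁻¹) ^ (q ^ i) := by
        intro i _
        have h5 : algebraMap F K u * σ x + algebraMap F K v * (σ x)⁻¹
          = σ (algebraMap F K u * x + algebraMap F K v * x⁻¹) := by
          rw [map_add, map_mul, map_mul, AlgHom.commutes, AlgHom.commutes, map_inv₀]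
        rw [h5, hσ, ← hR, ← pow_mul, ← pow_add]
      rw [Finset.sum_congr rfl this]
    have hinj : Function.Injective σ := RingHom.injective σ.toRingHom
    apply hinj
    rw [map_zero, ← Polynomial.aeval_algHom_apply]
    have hx1 : x ^ (S * k) ≠ 0 := pow_ne_zero _ hx0
    apply mul_left_cancel₀ hx1
    have h6 := congrArg (fun p => (σ x) ^ (S * k) * Polynomial.aeval x p) h1
    simp only [map_zero, mul_zero] at h6
    rw [mul_zero, ← h6, hΦ, map_sum, map_sum, Finset.mul_sum, Finset.mul_sum]
    refine Finset.sum_congr rfl ?_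
    rintro ⟨⟨c, hc⟩, ⟨b, hb⟩, ⟨a, ha⟩⟩ -
    have hDev : Polynomial.aeval (σ x) D = (σ x) ^ S * A x := by
      rw [hDdef, map_sub, hBev _ hy0, ← hAA]
      simp only [map_mul, Polynomial.aeval_C, map_pow, Polynomial.aeval_X]
      ring
    simp only [map_mul, map_pow, Polynomial.aeval_C, Polynomial.aeval_X, hDev, hBev x hx0]
    obtain ⟨b', rfl⟩ : ∃ b', k = b + b' := ⟨k - b, by omega⟩
    rw [Nat.add_sub_cancel_left]
    have e1 : (σ x) ^ (S * (b + b' + 1) * a) = x ^ a := by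
      rw [pow_mul, ← hσ, hσσ]
    have e2 : x ^ (S * (b + b' + 1) * c) = (σ x) ^ c := by
      rw [pow_mul, ← hσ]
    rw [pow_add, pow_add, pow_add x, pow_add x, e1, e2, mul_pow, mul_pow, mul_add S, pow_add, pow_add, pow_mul, pow_mul, pow_mul, pow_mul]
    ring
  have hroots : s.card ≤ (Φ.map (algebraMap F K)).natDegree := by
    apply Polynomial.card_le_degree_of_subset_roots
    intro x hx
    rw [Polynomial.mem_roots ((Polynomial.map_ne_zero_iff (algebraMap F K).injective).mpr h2),
      Polynomial.IsRoot.def, Polynomial.eval_map_algebraMap]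
    exact key x hx
  rw [Polynomial.natDegree_map] at hroots
  rw [hR]
  exact hroots.trans h3

theorem kl_rough {F K : Type} [Field F] [Fintype F] [Field K] [Fintype K] [Algebra F K]
    (ψ : AddChar F ℂ) (hψ : ψ.IsPrimitive) (Ψ : AddChar K ℂ)
    (hΨ : ∀ x, Ψ x = ψ (Algebra.trace F K x))
    (m : ℕ) (hK : Fintype.card K = (Fintype.card F ^ (m + 1)) ^ 2)
    (u v : F) (hu : u ≠ 0) :
    ‖kl Ψ (algebraMap F K u) (algebraMap F K v)‖
      ≤ 3 * (Fintype.card F : ℝ) ^ 2 * (Fintype.card F : ℝ) ^ (m + 1) := by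
  classical
  set q := Fintype.card F with hq
  have hq1 : 1 ≤ q := Fintype.card_pos
  set f : K → F := fun x =>
    Algebra.trace F K (algebraMap F K u * x + algebraMap F K v * x⁻¹) with hf
  set N : F → Finset K := fun e => Finset.univ.filter fun x => x ≠ 0 ∧ f x = e with hN
  have hup : ∀ e, (N e).card ≤ q ^ m * q ^ (m + 1) + 3 * q ^ (m + 1) := by
    intro e
    apply stepanov m hK u v hu e
    intro x hx
    exact (Finset.mem_filter.mp hx).2
  have htot : ∑ e : F, ((N e).card : ℝ) = (q : ℝ) ^ (m + 1) * q ^ (m + 1) - 1 := by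
    have h1 : (Finset.univ.filter fun x : K => x ≠ 0).card = ∑ e : F, (N e).card := by
      rw [Finset.card_eq_sum_card_fiberwise (f := f) (t := Finset.univ) (by simp)]
      refine Finset.sum_congr rfl fun e _ => ?_
      rw [Finset.filter_filter]
    have h2 : (Finset.univ.filter fun x : K => x ≠ 0).card + 1 = Fintype.card K := by
      rw [Finset.filter_ne' Finset.univ (0 : K), Finset.card_erase_of_mem (Finset.mem_univ _),
        Finset.card_univ]
      have := Fintype.card_pos (α := K)
      omega
    rw [h1, hK] at h2
    have h3 := congrArg (Nat.cast : ℕ → ℝ) h2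
    push_cast at h3
    rw [eq_sub_iff_add_eq, h3]; ring
  set R : ℝ := (q : ℝ) ^ (m + 1) with hRdef
  set S : ℝ := (q : ℝ) ^ m with hSdef
  have hqr : (1 : ℝ) ≤ q := by exact_mod_cast hq1
  have hR1 : 1 ≤ R := one_le_pow₀ hqr
  have hRS : R = q * S := by rw [hRdef, pow_succ]; ring
  have hup' : ∀ e, ((N e).card : ℝ) - S * R ≤ 3 * R := by
    intro e
    have := hup e
    have h2 : ((N e).card : ℝ) ≤ ((q ^ m * q ^ (m + 1) + 3 * q ^ (m + 1) : ℕ) : ℝ) := by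
      exact_mod_cast this
    push_cast at h2
    linarith
  have htot' : ∑ e : F, (((N e).card : ℝ) - S * R) = - 1 := by
    rw [Finset.sum_sub_distrib, htot, Finset.sum_const, Finset.card_univ, ← hq, nsmul_eq_mul, hRS]
    ring
  have habs : ∀ e, |((N e).card : ℝ) - S * R| ≤ 3 * q * R := by
    intro e
    rw [abs_le]
    constructor
    · have h1 := Finset.add_sum_erase Finset.univ (fun e => ((N e).card : ℝ) - S * R)
        (Finset.mem_univ e)
      rw [htot'] at h1
      have h2 : ∑ e ∈ Finset.univ.erase e, (((N e).card : ℝ) - S * R)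
          ≤ ∑ e ∈ Finset.univ.erase e, 3 * R := Finset.sum_le_sum fun e _ => hup' e
      rw [Finset.sum_const, Finset.card_erase_of_mem (Finset.mem_univ _), Finset.card_univ,
        ← hq, nsmul_eq_mul, Nat.cast_sub hq1] at h2
      push_cast at h2
      nlinarith
    · have := hup' e
      nlinarith
  have hkl : kl Ψ (algebraMap F K u) (algebraMap F K v)
      = ∑ e : F, ((((N e).card : ℝ) - S * R : ℝ) : ℂ) * ψ e := by
    have h0 : ∑ e : F, ψ e = 0 := by
      have := AddChar.sum_mulShift (1 : F) hψ
      simpa using this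
    have h1 : kl Ψ (algebraMap F K u) (algebraMap F K v)
        = ∑ e : F, ((N e).card : ℂ) * ψ e := by
      rw [kl, ← Finset.sum_fiberwise Finset.univ f]
      refine Finset.sum_congr rfl fun e _ => ?_
      have : ∀ x ∈ Finset.univ.filter (fun x => f x = e),
          (if x = 0 then (0 : ℂ) else Ψ (algebraMap F K u * x + algebraMap F K v * x⁻¹))
          = if x ≠ 0 then ψ e else 0 := by
        intro x hx
        have hx2 := (Finset.mem_filter.mp hx).2
        by_cases hx0 : x = 0
        · simp [hx0]
        · rw [if_neg hx0, if_pos hx0, hΨ, ← hx2]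
      rw [Finset.sum_congr rfl this, ← Finset.sum_filter, Finset.filter_filter,
        Finset.sum_const, nsmul_eq_mul]
      simp only [hN, and_comm]
    have h2 : ∀ e : F, ((((N e).card : ℝ) - S * R : ℝ) : ℂ) * ψ e
        = ((N e).card : ℂ) * ψ e - ((S * R : ℝ) : ℂ) * ψ e := by
      intro e; push_cast; ring
    simp_rw [h2]
    rw [Finset.sum_sub_distrib, ← Finset.mul_sum, h0, h1]
    ring
  rw [hkl]
  refine (norm_sum_le _ _).trans ?_
  have : ∀ e ∈ (Finset.univ : Finset F), ‖((((N e).card : ℝ) - S * R : ℝ) : ℂ) * ψ e‖ ≤ 3 * q * R := by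
    intro e _
    rw [norm_mul, AddChar.norm_apply, mul_one, Complex.norm_real, Real.norm_eq_abs]
    exact habs e
  refine (Finset.sum_le_sum this).trans ?_
  rw [Finset.sum_const, Finset.card_univ, ← hq, nsmul_eq_mul]
  apply le_of_eq
  ring

theorem kl_conj {K : Type} [Field K] [Fintype K] (ψ : AddChar K ℂ) (u v : K) :
    ∃ r : ℝ, kl ψ u v = r := by
  classical
  have : (starRingEnd ℂ) (kl ψ u v) = kl ψ u v := by
    rw [kl, map_sum]
    refine Fintype.sum_equiv (Equiv.neg K) _ _ fun x => ?_
    by_cases hx : x = 0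
    · simp [hx]
    · rw [if_neg hx, Equiv.neg_apply, if_neg (neg_ne_zero.mpr hx), ← AddChar.map_neg_eq_conj]
      congr 1
      rw [inv_neg]; ring
  exact ⟨_, (Complex.conj_eq_iff_re.mp this).symm⟩

theorem qa_re {K : Type} [Field K] (c u v : K) [Fact (∀ r : K, r ^ 2 ≠ c + 0 * r)]
    (x : QuadraticAlgebra K c 0) :
    2 * (algebraMap K (QuadraticAlgebra K c 0) u * x
      + algebraMap K (QuadraticAlgebra K c 0) v * x⁻¹).re
    = x.re * (2 * (u + v * (x.re ^ 2 - c * x.im ^ 2)⁻¹)) := by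
  have h : x.norm = x.re ^ 2 - c * x.im ^ 2 := by rw [QuadraticAlgebra.norm_def]; ring
  rw [← h]
  simp [QuadraticAlgebra.inv_def]
  ring

theorem tower {F : Type} [Field F] [Fintype F] (hq : Odd (Fintype.card F))
    (ψ : AddChar F ℂ) (hψ : ψ.IsPrimitive) (u v : F) (hu : u ≠ 0) (hv : v ≠ 0)
    (δ : ℝ) (hδ : 0 ≤ δ)
    (h : (2 + δ) * Real.sqrt (Fintype.card F) ≤ ‖kl ψ u v‖) (k : ℕ) :
    ∃ (K : Type) (_ : Field K) (_ : Fintype K) (_ : Algebra F K) (Ψ : AddChar K ℂ),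
      Ψ.IsPrimitive ∧ (∀ x, Ψ x = ψ (Algebra.trace F K x)) ∧
      Fintype.card K = Fintype.card F ^ (2 ^ k) ∧
      (2 + 4 ^ k * δ) * Real.sqrt (Fintype.card K) ≤
        ‖kl Ψ (algebraMap F K u) (algebraMap F K v)‖ := by
  induction k with
  | zero =>
    refine ⟨F, inferInstance, inferInstance, inferInstance, ψ, hψ, ?_, by simp, ?_⟩
    · intro x; rw [Algebra.trace_self_apply]
    · simpa using h
  | succ k ih =>
    obtain ⟨K, _, _, _, Ψ, hΨ, htr, hcard, hlow⟩ := ih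
    have hqK : Odd (Fintype.card K) := by rw [hcard]; exact hq.pow
    have h2 := two_ne_zero_of_odd hqK
    obtain ⟨c, hc⟩ := FiniteField.exists_nonsquare (ringChar_ne_of_odd hqK)
    have : Fact (∀ r : K, r ^ 2 ≠ c + 0 * r) := ⟨by
      intro r hr
      exact hc ⟨r, by rw [zero_mul, add_zero] at hr; rw [← hr, sq]⟩⟩
    let L := QuadraticAlgebra K c 0
    let e : L ≃ K × K := QuadraticAlgebra.equivProd c 0
    let _ : Fintype L := Fintype.ofEquiv _ e.symm
    have hcL : Fintype.card L = Fintype.card K ^ 2 := by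
      rw [Fintype.card_congr e, Fintype.card_prod, sq]
    have htrL : ∀ x : L, Algebra.trace K L x = 2 * x.re := by
      intro x
      rw [Algebra.trace_eq_matrix_trace (QuadraticAlgebra.basis c 0), Matrix.trace_fin_two,
        Algebra.leftMulMatrix_eq_repr_mul, Algebra.leftMulMatrix_eq_repr_mul]
      simp [QuadraticAlgebra.basis]
      ring
    let Θ : AddChar L ℂ := Ψ.compAddMonoidHom (Algebra.trace K L).toAddMonoidHom
    have hΘ : ∀ x, Θ x = Ψ (2 * x.re) := by
      intro x
      show Ψ (Algebra.trace K L x) = _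
      rw [htrL]
    refine ⟨L, inferInstance, inferInstance, inferInstance, Θ, ?_, ?_, ?_, ?_⟩
    · apply AddChar.IsPrimitive.of_ne_one
      intro h1
      have h3 : Ψ ≠ 1 := by
        have := hΨ one_ne_zero
        rwa [AddChar.mulShift_one] at this
      apply h3
      ext x
      have h4 := hΘ (⟨x / 2, 0⟩ : L)
      rw [h1] at h4
      simp only [AddChar.one_apply] at h4 ⊢
      rw [h4]
      congr 1
      field_simp
    · intro x
      show Ψ (Algebra.trace K L x) = _
      rw [htr, Algebra.trace_trace]
    · rw [hcL, hcard, ← pow_mul, pow_succ]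
    · have hquad := kl_quad hqK Ψ hΨ Θ c hc e (algebraMap F K u) (algebraMap F K v)
        (by simpa using hu) (by simpa using hv) (algebraMap F L u) (algebraMap F L v)
        (by
          intro x
          rw [← QuadraticAlgebra.norm_eq_zero_iff_eq_zero, QuadraticAlgebra.norm_def]
          show _ ↔ x.re ^ 2 - c * x.im ^ 2 = 0
          constructor <;> intro h <;> linear_combination h)
        (by
          intro x hx
          rw [hΘ]
          congr 1
          rw [IsScalarTower.algebraMap_apply F K L u, IsScalarTower.algebraMap_apply F K L v]
          exact qa_re c _ _ x)
      obtain ⟨r, hr⟩ := kl_conj Ψ (algebraMap F K u) (algebraMap F K v)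
      rw [hr, Complex.norm_real, Real.norm_eq_abs] at hlow
      rw [hquad, hr]
      have e1 : (2 * (Fintype.card K : ℂ) - (r : ℂ) ^ 2) = ((2 * (Fintype.card K : ℝ) - r ^ 2 : ℝ) : ℂ) := by
        push_cast; ring
      rw [e1, Complex.norm_real, Real.norm_eq_abs, hcL]
      push_cast
      rw [Real.sqrt_sq (by positivity)]
      set Q : ℝ := (Fintype.card K : ℝ) with hQ
      have hQ0 : 0 ≤ Q := by positivity
      have hs := Real.sq_sqrt hQ0
      have h5 : ((2 + 4 ^ k * δ) * Real.sqrt Q) ^ 2 ≤ r ^ 2 := by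
        rw [← sq_abs r]
        gcongr
      rw [mul_pow, hs] at h5
      have h6 := neg_le_abs (2 * Q - r ^ 2)
      have h7 : 0 ≤ (4 ^ k * δ) ^ 2 * Q := by positivity
      rw [pow_succ]
      nlinarith

theorem kl_bound {F : Type} [Field F] [Fintype F] (hq : Odd (Fintype.card F))
    (ψ : AddChar F ℂ) (hψ : ψ.IsPrimitive) (u v : F) (hu : u ≠ 0) :
    ‖kl ψ u v‖ ≤ 2 * Real.sqrt (Fintype.card F) := by
  classical
  have hq1 : (1 : ℝ) ≤ Fintype.card F := by exact_mod_cast Fintype.card_pos (α := F)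
  have hs1 : 1 ≤ Real.sqrt (Fintype.card F) := Real.one_le_sqrt.mpr hq1
  by_cases hv : v = 0
  · have : kl ψ u v = -1 := by
      have h1 := AddChar.sum_mulShift u hψ
      rw [if_neg hu, ← Finset.add_sum_erase _ _ (Finset.mem_univ (0 : F))] at h1
      rw [kl, ← Finset.add_sum_erase _ _ (Finset.mem_univ (0 : F)), if_pos rfl, zero_add,
        Finset.sum_congr rfl (g := fun x => ψ (x * u))]
      · simp only [zero_mul, AddChar.map_zero_eq_one, Nat.cast_zero] at h1
        linear_combination h1
      · intro x hx
        rw [if_neg (Finset.ne_of_mem_erase hx), hv, zero_mul, add_zero, mul_comm]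
    rw [this, norm_neg, norm_one]
    linarith
  by_contra hcon
  push Not at hcon
  set q : ℝ := (Fintype.card F : ℝ) with hqdef
  set δ := ‖kl ψ u v‖ / Real.sqrt q - 2 with hδ
  have hδ0 : 0 < δ := by
    rw [hδ, sub_pos, lt_div_iff₀ (by linarith)]
    exact hcon
  have h0 : (2 + δ) * Real.sqrt q ≤ ‖kl ψ u v‖ := by
    rw [hδ]
    apply le_of_eq
    have : Real.sqrt q ≠ 0 := by linarith
    field_simp
    ring
  obtain ⟨n, hn⟩ := pow_unbounded_of_one_lt (3 * q ^ 2 / δ) (by norm_num : (1 : ℝ) < 4)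
  obtain ⟨K, _, _, _, Ψ, hΨ, htr, hcard, hlow⟩ :=
    tower hq ψ hψ u v hu hv δ hδ0.le h0 (n + 1)
  obtain ⟨m, hm⟩ : ∃ m, 2 ^ n = m + 1 := ⟨2 ^ n - 1, by have := Nat.one_le_two_pow (n := n); omega⟩
  have hc2 : Fintype.card K = (Fintype.card F ^ (m + 1)) ^ 2 := by
    rw [hcard, pow_succ 2 n, hm, pow_mul]
  have hup := kl_rough ψ hψ Ψ htr m hc2 u v hu
  rw [hc2] at hlow
  push_cast at hlow
  rw [Real.sqrt_sq (by positivity)] at hlow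
  have h1 := hlow.trans hup
  have h2 := le_of_mul_le_mul_right h1 (by positivity)
  rw [div_lt_iff₀ hδ0] at hn
  have h3 : (4 : ℝ) ^ n * δ ≤ 4 ^ (n + 1) * δ := by
    have : (4 : ℝ) ^ n ≤ 4 ^ (n + 1) := pow_le_pow_right₀ (by norm_num) (by omega)
    gcongr
  linarith

theorem exp_sum_eval {F : Type} [Field F] [Fintype F] (hq : Odd (Fintype.card F))
    (ψ : AddChar F ℂ) (hψ : ψ.IsPrimitive) (a : F) :
    ∃ ε : ℤ, (ε = 1 ∨ ε = -1) ∧ ∀ b₁ b₂ : F,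
      (∑ p : F × F, open Classical in
        if p.1 ^ 2 + p.2 ^ 2 = a then ψ (b₁ * p.1 + b₂ * p.2) else 0)
      = (open Classical in if b₁ = 0 ∧ b₂ = 0 then (Fintype.card F : ℂ) else 0)
        + ε * kl ψ (-a) (-(b₁ ^ 2 + b₂ ^ 2) / 4) := by
  classical
  have h2 := two_ne_zero_of_odd hq
  have h4 : (4 : F) ≠ 0 := by
    have : (4 : F) = 2 * 2 := by norm_num
    rw [this]; exact mul_ne_zero h2 h2
  have hc0 : (Fintype.card F : ℂ) ≠ 0 := by exact_mod_cast Fintype.card_ne_zero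
  have hchar := ringChar_ne_of_odd hq
  refine ⟨quadraticChar F (-1), ?_, ?_⟩
  · exact quadraticChar_dichotomy (neg_ne_zero.mpr one_ne_zero)
  -- Gauss sums
  have hG : ∀ t : F, t ≠ 0 → (∑ x : F, ψ (t * x ^ 2)) ^ 2
      = (quadraticChar F (-1) : ℂ) * Fintype.card F := by
    intro t ht
    have hp : (ψ.mulShift t).IsPrimitive := by
      apply AddChar.IsPrimitive.of_ne_one
      exact hψ ht
    let χ : MulChar F ℂ := (quadraticChar F).ringHomComp (Int.castRingHom ℂ)
    have hχ1 : χ ≠ 1 := by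
      intro h
      obtain ⟨x, hx⟩ := quadraticChar_exists_neg_one hchar
      have hx0 : x ≠ 0 := by
        rintro rfl
        simp at hx
      have h5 : χ x = 1 := by
        rw [h]; exact MulChar.one_apply (isUnit_iff_ne_zero.mpr hx0)
      have h6 : χ x = -1 := by
        show ((quadraticChar F x : ℤ) : ℂ) = -1
        rw [hx]; simp
      rw [h5] at h6
      norm_num at h6
    have hχ2 : χ.IsQuadratic := (quadraticChar_isQuadratic F).comp _
    have h7 := gaussSum_sq hχ1 hχ2 hp
    have h8 : ∑ x : F, ψ (t * x ^ 2) = gaussSum χ (ψ.mulShift t) := by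
      rw [sum_sq_eq hq (fun k => ψ (t * k)), gaussSum]
      simp_rw [add_mul, one_mul]
      rw [Finset.sum_add_distrib]
      have h9 : ∑ k : F, ψ (t * k) = 0 := by
        have := AddChar.sum_mulShift t hψ
        rw [if_neg ht] at this
        simp_rw [mul_comm t]
        simpa using this
      rw [h9, add_zero]
      rfl
    rw [h8, h7]
    rfl
  have hsq : ∀ t b : F, t ≠ 0 →
      ∑ x : F, ψ (t * x ^ 2 + b * x) = ψ (-(b ^ 2) / (4 * t)) * ∑ x : F, ψ (t * x ^ 2) := by
    intro t b ht
    rw [Finset.mul_sum]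
    refine Fintype.sum_equiv (Equiv.addRight (b / (2 * t))) _ _ fun x => ?_
    rw [← AddChar.map_add_eq_mul, Equiv.coe_addRight]
    congr 1
    field_simp
    ring
  intro b₁ b₂
  have horth : ∀ y : F, (if y = a then (1 : ℂ) else 0)
      = (Fintype.card F : ℂ)⁻¹ * ∑ t : F, ψ (t * (y - a)) := by
    intro y
    rw [AddChar.sum_mulShift _ hψ]
    by_cases h : y = a
    · rw [if_pos h, if_pos (sub_eq_zero.mpr h), inv_mul_cancel₀ hc0]
    · rw [if_neg h, if_neg (fun h' => h (sub_eq_zero.mp h'))]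
      simp
  have hinner : ∀ t : F, ∑ p : F × F, ψ (t * (p.1 ^ 2 + p.2 ^ 2 - a)) * ψ (b₁ * p.1 + b₂ * p.2)
      = ψ (t * -a) * ((∑ x : F, ψ (t * x ^ 2 + b₁ * x)) * ∑ x : F, ψ (t * x ^ 2 + b₂ * x)) := by
    intro t
    rw [Finset.sum_mul_sum, ← Fintype.sum_prod_type', Finset.mul_sum]
    refine Finset.sum_congr rfl fun p _ => ?_
    rw [← AddChar.map_add_eq_mul, ← AddChar.map_add_eq_mul, ← AddChar.map_add_eq_mul]
    congr 1
    ring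
  have hmain : (∑ p : F × F, if p.1 ^ 2 + p.2 ^ 2 = a then ψ (b₁ * p.1 + b₂ * p.2) else 0)
      = (Fintype.card F : ℂ)⁻¹ * ∑ t : F, ψ (t * -a) *
        ((∑ x : F, ψ (t * x ^ 2 + b₁ * x)) * ∑ x : F, ψ (t * x ^ 2 + b₂ * x)) := by
    simp_rw [← hinner]
    rw [Finset.sum_comm, Finset.mul_sum]
    refine Finset.sum_congr rfl fun p _ => ?_
    rw [← Finset.sum_mul, ← mul_assoc, ← horth]
    split_ifs <;> simp
  rw [hmain, ← Finset.add_sum_erase _ _ (Finset.mem_univ (0 : F)), mul_add]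
  congr 1
  · simp only [zero_mul, zero_add, AddChar.map_zero_eq_one, one_mul]
    have hb : ∀ b : F, ∑ x : F, ψ (b * x) = if b = 0 then (Fintype.card F : ℂ) else 0 := by
      intro b
      simp_rw [mul_comm b]
      rw [AddChar.sum_mulShift _ hψ]
      split_ifs <;> simp
    rw [hb, hb]
    by_cases h1 : b₁ = 0 <;> by_cases h2 : b₂ = 0 <;> simp [h1, h2]
  · rw [kl, ← Finset.add_sum_erase _ _ (Finset.mem_univ (0 : F)), if_pos rfl, zero_add,
      Finset.mul_sum, Finset.mul_sum]
    refine Finset.sum_congr rfl fun t ht => ?_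
    have ht0 : t ≠ 0 := Finset.ne_of_mem_erase ht
    rw [if_neg ht0, hsq t b₁ ht0, hsq t b₂ ht0]
    have e1 : -a * t + -(b₁ ^ 2 + b₂ ^ 2) / 4 * t⁻¹
        = t * -a + (-(b₁ ^ 2) / (4 * t) + -(b₂ ^ 2) / (4 * t)) := by
      field_simp
      ring
    rw [e1, AddChar.map_add_eq_mul, AddChar.map_add_eq_mul]
    have h5 := hG t ht0
    generalize ψ (-(b₁ ^ 2) / (4 * t)) = A₁
    generalize ψ (-(b₂ ^ 2) / (4 * t)) = A₂
    generalize ψ (t * -a) = A₃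
    rw [inv_mul_eq_iff_eq_mul₀ hc0]
    linear_combination A₁ * A₂ * A₃ * h5

theorem kl_zero {F : Type} [Field F] [Fintype F] (ψ : AddChar F ℂ) (hψ : ψ.IsPrimitive)
    (u : F) (hu : u ≠ 0) : kl ψ u 0 = -1 := by
  classical
  have h1 := AddChar.sum_mulShift u hψ
  rw [if_neg hu, ← Finset.add_sum_erase _ _ (Finset.mem_univ (0 : F))] at h1
  rw [kl, ← Finset.add_sum_erase _ _ (Finset.mem_univ (0 : F)), if_pos rfl, zero_add,
    Finset.sum_congr rfl (g := fun x => ψ (x * u))]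
  · simp only [zero_mul, AddChar.map_zero_eq_one, Nat.cast_zero] at h1
    linear_combination h1
  · intro x hx
    rw [if_neg (Finset.ne_of_mem_erase hx), zero_mul, add_zero, mul_comm]

theorem stmt_11 (F : Type) [Field F] [Fintype F] (hq : Odd (Fintype.card F))
    (a : F) (ha : a ≠ 0) (G : SimpleGraph (Fin 2 → F)) [DecidableRel G.Adj]
    (hAdj : ∀ x y : Fin 2 → F, G.Adj x y ↔ x ≠ y ∧ fnorm (x - y) = a) :
    ∃ d : ℕ, (d = Fintype.card F - 1 ∨ d = Fintype.card F + 1) ∧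
      G.IsRegularOfDegree d ∧
      ∀ (μ : ℝ) (v : (Fin 2 → F) → ℝ), v ≠ 0 →
        (G.adjMatrix ℝ) *ᵥ v = μ • v → μ ≠ (d : ℝ) →
        |μ| ≤ 2 * Real.sqrt (Fintype.card F) := by
  classical
  have hψ := AddChar.FiniteField.primitiveChar_to_Complex_isPrimitive F
  set ψ := AddChar.FiniteField.primitiveChar_to_Complex F with hψdef
  obtain ⟨ε, hε, hsum⟩ := exp_sum_eval hq ψ hψ a
  have hq1 : 1 ≤ Fintype.card F := Fintype.card_pos
  have hAdj' : ∀ x y : Fin 2 → F, G.Adj x y ↔ fnorm (x - y) = a := by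
    intro x y
    rw [hAdj]
    refine ⟨fun h => h.2, fun h => ⟨?_, h⟩⟩
    rintro rfl
    apply ha
    rw [← h]
    simp [fnorm]
  -- the exponential sums over the circle
  set lam : (Fin 2 → F) → ℂ := fun b =>
    ∑ z : Fin 2 → F, if fnorm z = a then ψ (b 0 * z 0 + b 1 * z 1) else 0 with hlam
  have hlam' : ∀ b : Fin 2 → F, lam b = (if b 0 = 0 ∧ b 1 = 0 then (Fintype.card F : ℂ) else 0)
        + ε * kl ψ (-a) (-(b 0 ^ 2 + b 1 ^ 2) / 4) := by
    intro b
    rw [← hsum]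
    refine Fintype.sum_equiv (finTwoArrowEquiv F) _ _ fun z => ?_
    simp only [fnorm, finTwoArrowEquiv_apply]
    congr
  have ha' : -a ≠ 0 := neg_ne_zero.mpr ha
  have hcount : ∀ x : Fin 2 → F, ((G.degree x : ℕ) : ℂ) = lam 0 := by
    intro x
    rw [← SimpleGraph.card_neighborFinset_eq_degree, SimpleGraph.neighborFinset_eq_filter,
      Finset.card_filter]
    push_cast
    refine Fintype.sum_equiv (Equiv.subLeft x) _ _ fun y => ?_
    simp only [hAdj', Equiv.subLeft_apply, Pi.zero_apply, zero_mul, add_zero,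
      AddChar.map_zero_eq_one]
  have hlam0 : lam 0 = Fintype.card F - ε := by
    rw [hlam']
    simp only [Pi.zero_apply, and_self, if_true]
    have : (-((0 : F) ^ 2 + 0 ^ 2) / 4) = 0 := by simp
    rw [this, kl_zero ψ hψ _ ha']
    ring
  obtain ⟨d, hd, hdc⟩ : ∃ d : ℕ, (d = Fintype.card F - 1 ∨ d = Fintype.card F + 1) ∧
      (d : ℂ) = lam 0 := by
    rcases hε with h | h
    · refine ⟨_, Or.inl rfl, ?_⟩
      rw [hlam0, h, Nat.cast_sub hq1]; simp
    · refine ⟨_, Or.inr rfl, ?_⟩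
      rw [hlam0, h]; push_cast; ring
  refine ⟨d, hd, ?_, ?_⟩
  · intro x
    have := hcount x
    rw [← hdc] at this
    exact_mod_cast this
  intro μ v hv hμ hμd
  -- Fourier transform
  set vh : (Fin 2 → F) → ℂ := fun b => ∑ x : Fin 2 → F, (v x : ℂ) * ψ (b 0 * x 0 + b 1 * x 1)
    with hvh
  have heig : ∀ b, (μ : ℂ) * vh b = lam b * vh b := by
    intro b
    have h1 : ∀ x, (μ : ℂ) * v x = ∑ y, if fnorm (x - y) = a then (v y : ℂ) else 0 := by
      intro x
      have h2 := congrFun hμ x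
      simp only [Matrix.mulVec, dotProduct, SimpleGraph.adjMatrix_apply, Pi.smul_apply,
        smul_eq_mul, hAdj'] at h2
      have h3 := congrArg (Complex.ofReal) h2
      push_cast at h3
      rw [← h3]
      refine Finset.sum_congr rfl fun y _ => ?_
      split_ifs <;> simp
    simp only [hvh]
    rw [Finset.mul_sum]
    simp_rw [← mul_assoc, h1, Finset.sum_mul]
    rw [Finset.sum_comm, Finset.mul_sum]
    refine Finset.sum_congr rfl fun y _ => ?_
    simp only [hlam]
    rw [Finset.sum_mul]
    refine Fintype.sum_equiv (Equiv.subRight y) _ _ fun x => ?_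
    simp only [Equiv.subRight_apply]
    split_ifs with h
    · have e1 : b 0 * x 0 + b 1 * x 1
          = (b 0 * (x - y) 0 + b 1 * (x - y) 1) + (b 0 * y 0 + b 1 * y 1) := by
        simp only [Pi.sub_apply]; ring
      rw [e1, AddChar.map_add_eq_mul]
      ring
    · simp
  have hex : ∃ b, vh b ≠ 0 := by
    by_contra hcon
    push Not at hcon
    apply hv
    ext z
    have h1 : ∑ b : Fin 2 → F, vh b * ψ (-(b 0 * z 0 + b 1 * z 1)) = 0 := by
      simp [hcon]
    have horth : ∀ w : Fin 2 → F, ∑ b : Fin 2 → F, ψ (b 0 * w 0 + b 1 * w 1)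
        = if w = 0 then (Fintype.card F : ℂ) ^ 2 else 0 := by
      intro w
      have h2 : ∑ b : Fin 2 → F, ψ (b 0 * w 0 + b 1 * w 1)
          = (∑ s : F, ψ (s * w 0)) * ∑ s : F, ψ (s * w 1) := by
        rw [Finset.sum_mul_sum, ← Fintype.sum_prod_type']
        refine Fintype.sum_equiv (finTwoArrowEquiv F) _ _ fun z => ?_
        rw [AddChar.map_add_eq_mul]
        rfl
      rw [h2, AddChar.sum_mulShift _ hψ, AddChar.sum_mulShift _ hψ]
      have h3 : w = 0 ↔ w 0 = 0 ∧ w 1 = 0 := by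
        constructor
        · rintro rfl; simp
        · rintro ⟨h, h'⟩
          ext i
          fin_cases i
          · exact h
          · exact h'
      simp only [h3]
      by_cases h4 : w 0 = 0 <;> by_cases h5 : w 1 = 0 <;> simp [h4, h5, sq]
    simp only [hvh, Finset.sum_mul] at h1
    rw [Finset.sum_comm] at h1
    have h2 : ∀ x : Fin 2 → F, ∑ b : Fin 2 → F,
        (v x : ℂ) * ψ (b 0 * x 0 + b 1 * x 1) * ψ (-(b 0 * z 0 + b 1 * z 1))
        = if x = z then (v x : ℂ) * (Fintype.card F : ℂ) ^ 2 else 0 := by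
      intro x
      have h3 := horth (x - z)
      simp_rw [mul_assoc, ← AddChar.map_add_eq_mul]
      rw [← Finset.mul_sum]
      have e1 : ∀ b : Fin 2 → F, b 0 * x 0 + b 1 * x 1 + -(b 0 * z 0 + b 1 * z 1)
          = b 0 * (x - z) 0 + b 1 * (x - z) 1 := by
        intro b
        simp only [Pi.sub_apply]; ring
      simp_rw [e1]
      rw [h3]
      simp only [sub_eq_zero]
      split_ifs <;> simp
    simp_rw [h2] at h1
    rw [Finset.sum_ite_eq' Finset.univ z, if_pos (Finset.mem_univ _)] at h1
    have hc0 : (Fintype.card F : ℂ) ^ 2 ≠ 0 := by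
      exact pow_ne_zero _ (by exact_mod_cast Fintype.card_ne_zero)
    have := (mul_eq_zero.mp h1).resolve_right hc0
    simpa using this
  obtain ⟨b, hb⟩ := hex
  have hμl : (μ : ℂ) = lam b := mul_right_cancel₀ hb (heig b)
  have hb0 : ¬ (b 0 = 0 ∧ b 1 = 0) := by
    rintro ⟨h0, h1⟩
    have : b = 0 := by
      ext i
      fin_cases i
      · exact h0
      · exact h1
    rw [this, ← hdc] at hμl
    apply hμd
    exact_mod_cast hμl
  rw [hlam', if_neg hb0, zero_add] at hμl
  have h1 : |μ| = ‖(μ : ℂ)‖ := by rw [Complex.norm_real, Real.norm_eq_abs]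
  have h2 : ‖((ε : ℤ) : ℂ)‖ = 1 := by
    rcases hε with h | h <;> simp [h]
  rw [h1, hμl, norm_mul, h2, one_mul]
  exact kl_bound hq ψ hψ _ _ ha'
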